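/- arXiv:1602.00780 — 2 statements merged into one kernel-verified Lean document; each statement's English description precedes it below -/
import Mathlib

section
/- Let s > 2 be a real number. Then the three series A = Σ φ(γ)·N(γ)^{−s}, B = Σ N(γ)^{−s}, and C = Σ N(γ)^{−(s−1)}, each sum extending over all nonzero Gaussian integers γ, converge, and A·B = 4·C. -/
/-- Euler's totient function on the Gaussian integers: the number of units of `ℤ[i]/γℤ[i]`. -/
noncomputable def gaussianPhi (γ : GaussianInt) : ℕ :=
  Nat.card (GaussianInt ⧸ Ideal.span ({γ} : Set GaussianInt))ˣ


noncomputable def gBasis : Module.Basis (Fin 2) ℤ GaussianInt :=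
  Module.Basis.ofEquivFun
    { toFun := fun z => ![z.re, z.im]
      invFun := fun v => ⟨v 0, v 1⟩
      left_inv := fun z => by simp
      right_inv := fun v => by ext i; fin_cases i <;> simp
      map_add' := fun x y => by ext i; fin_cases i <;> simp
      map_smul' := fun c x => by ext i; fin_cases i <;> simp }

theorem gNorm (z : GaussianInt) : Algebra.norm ℤ z = z.norm := by
  rw [Algebra.norm_eq_matrix_det gBasis, Matrix.det_fin_two]
  simp [Algebra.leftMulMatrix_eq_repr_mul, gBasis, Zsqrtd.norm_def, Pi.single_apply]

theorem gCard (z : GaussianInt) :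
    (Nat.card (GaussianInt ⧸ Ideal.span ({z} : Set GaussianInt)) : ℤ) = z.norm := by
  haveI : Module.Free ℤ GaussianInt := Module.Free.of_basis gBasis
  haveI : Module.Finite ℤ GaussianInt := Module.Finite.of_basis gBasis
  rw [← GaussianInt.abs_natCast_norm, ← gNorm, ← Ideal.absNorm_span_singleton,
    Ideal.absNorm_apply, Submodule.cardQuot_apply]

theorem gFinite (z : GaussianInt) (hz : z ≠ 0) :
    Finite (GaussianInt ⧸ Ideal.span ({z} : Set GaussianInt)) := by
  apply Nat.finite_of_card_ne_zero
  have := gCard z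
  have := GaussianInt.norm_pos.2 hz
  omega

theorem gUnits : Nat.card GaussianIntˣ = 4 := by
  have h : Nat.card GaussianIntˣ = Nat.card {z : GaussianInt // z ∈
      ({⟨1, 0⟩, ⟨-1, 0⟩, ⟨0, 1⟩, ⟨0, -1⟩} : Finset GaussianInt)} := by
    apply Nat.card_eq_of_bijective (f := fun u => ⟨u.1, by
      have := (Zsqrtd.norm_eq_one_iff' (by norm_num) u.1).2 u.isUnit
      rw [Zsqrtd.norm_def] at this
      have h1 : u.1.re ≤ 1 := by nlinarith [mul_self_nonneg u.1.im]
      have h2 : -1 ≤ u.1.re := by nlinarith [mul_self_nonneg u.1.im]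
      have h3 : u.1.im ≤ 1 := by nlinarith
      have h4 : -1 ≤ u.1.im := by nlinarith
      simp only [Finset.mem_insert, Finset.mem_singleton, Zsqrtd.ext_iff]
      generalize u.1.re = a at *
      generalize u.1.im = b at *
      interval_cases a <;> interval_cases b <;> simp_all⟩)
    constructor
    · intro u v h
      simpa [Units.ext_iff] using h
    · rintro ⟨z, hz⟩
      have : IsUnit z := by
        rw [← Zsqrtd.norm_eq_one_iff' (by norm_num)]
        simp only [Finset.mem_insert, Finset.mem_singleton] at hz
        rcases hz with rfl | rfl | rfl | rfl <;> simp [Zsqrtd.norm_def]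
      exact ⟨this.unit, by simp⟩
  rw [h, Nat.card_eq_fintype_card, Fintype.card_coe]
  rfl

theorem mk_dvd (η a b : GaussianInt) :
    (Ideal.Quotient.mk (Ideal.span ({η} : Set GaussianInt)) a ∣ Ideal.Quotient.mk _ b) ↔
      ∃ c k, b = a * c + η * k := by
  constructor
  · rintro ⟨c, hc⟩
    obtain ⟨c, rfl⟩ := Ideal.Quotient.mk_surjective c
    rw [← map_mul, Ideal.Quotient.eq, Ideal.mem_span_singleton] at hc
    obtain ⟨k, hk⟩ := hc
    exact ⟨c, k, by linear_combination hk⟩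
  · rintro ⟨c, k, h⟩
    refine ⟨Ideal.Quotient.mk _ c, ?_⟩
    rw [← map_mul, Ideal.Quotient.eq, Ideal.mem_span_singleton]
    exact ⟨k, by linear_combination h⟩

theorem phi_eq (γ δ η : GaussianInt) (h : γ * δ = η) (hη : η ≠ 0) :
    gaussianPhi γ = Nat.card {x : GaussianInt ⧸ Ideal.span ({η} : Set GaussianInt) //
      x ∣ Ideal.Quotient.mk _ δ ∧ Ideal.Quotient.mk _ δ ∣ x} := by
  have hδ : δ ≠ 0 := by rintro rfl; simp at h; exact hη h.symm
  let f : (GaussianInt ⧸ Ideal.span ({γ} : Set GaussianInt)) →ₗ[GaussianInt]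
      (GaussianInt ⧸ Ideal.span ({η} : Set GaussianInt)) :=
    Submodule.mapQ _ _ (LinearMap.mulLeft GaussianInt δ) (by
      intro x hx
      rw [Ideal.mem_span_singleton] at hx
      obtain ⟨k, rfl⟩ := hx
      simp only [Submodule.mem_comap, LinearMap.mulLeft_apply]
      rw [Ideal.mem_span_singleton]
      exact ⟨k, by rw [← h]; ring⟩)
  have hf : ∀ u, f (Ideal.Quotient.mk _ u) = Ideal.Quotient.mk _ (δ * u) := fun u => rfl
  have hinj : Function.Injective f := by
    intro a b hab
    obtain ⟨a, rfl⟩ := Ideal.Quotient.mk_surjective a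
    obtain ⟨b, rfl⟩ := Ideal.Quotient.mk_surjective b
    rw [hf, hf, Ideal.Quotient.eq, Ideal.mem_span_singleton] at hab
    rw [Ideal.Quotient.eq, Ideal.mem_span_singleton]
    obtain ⟨k, hk⟩ := hab
    exact ⟨k, mul_left_cancel₀ hδ (by rw [← h] at hk; linear_combination hk)⟩
  have hunit : ∀ u, IsUnit u ↔ (f u ∣ Ideal.Quotient.mk _ δ ∧ Ideal.Quotient.mk _ δ ∣ f u) := by
    intro u
    obtain ⟨u, rfl⟩ := Ideal.Quotient.mk_surjective u
    rw [hf, mk_dvd, mk_dvd, isUnit_iff_dvd_one, ← map_one (Ideal.Quotient.mk _), mk_dvd]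
    constructor
    · rintro ⟨c, k, hk⟩
      exact ⟨⟨c, k, by rw [← h]; linear_combination δ * hk⟩, ⟨u, 0, by ring⟩⟩
    · rintro ⟨⟨c, k, hk⟩, -⟩
      exact ⟨c, k, mul_left_cancel₀ hδ (by rw [← h] at hk; linear_combination hk)⟩
  unfold gaussianPhi
  apply Nat.card_eq_of_bijective (f := fun u => ⟨f u.1, (hunit _).1 u.isUnit⟩)
  constructor
  · intro u v huv
    exact Units.ext (hinj (Subtype.ext_iff.1 huv))
  · rintro ⟨x, h1, h2⟩
    obtain ⟨x, rfl⟩ := Ideal.Quotient.mk_surjective x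
    obtain ⟨c, k, hk⟩ := (mk_dvd _ _ _).1 h2
    have hx : f (Ideal.Quotient.mk _ (c + γ * k)) = Ideal.Quotient.mk _ x := by
      rw [hf]; congr 1; rw [hk, ← h]; ring
    have hu : IsUnit (Ideal.Quotient.mk (Ideal.span ({γ} : Set GaussianInt)) (c + γ * k)) := by
      rw [hunit, hx]; exact ⟨h1, h2⟩
    exact ⟨hu.unit, Subtype.ext hx⟩

abbrev NZ := {γ : GaussianInt // γ ≠ 0}

theorem fib_finite (η : NZ) : Finite {p : NZ × NZ // p.1.1 * p.2.1 = η.1} := by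
  haveI : Finite GaussianIntˣ := Nat.finite_of_card_ne_zero (by rw [gUnits]; norm_num)
  haveI : Fintype GaussianIntˣ := Fintype.ofFinite _
  haveI := UniqueFactorizationMonoid.fintypeSubtypeDvd η.1 η.2
  refine Finite.of_injective (β := {x // x ∣ η.1}) (fun p => ⟨p.1.2.1, ⟨p.1.1.1, by linear_combination -p.2⟩⟩) ?_
  rintro ⟨⟨a, b⟩, hp⟩ ⟨⟨c, d⟩, hq⟩ h
  have hbd : b = d := Subtype.ext (congrArg (fun z : {x // x ∣ η.1} => z.1) h)
  subst hbd
  have : a = c := Subtype.ext (mul_right_cancel₀ b.2 (hp.trans hq.symm))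
  subst this
  rfl

theorem fib_card (η : NZ) (x : GaussianInt ⧸ Ideal.span ({η.1} : Set GaussianInt)) :
    Nat.card {p : {p : NZ × NZ // p.1.1 * p.2.1 = η.1} //
      x ∣ Ideal.Quotient.mk _ p.1.2.1 ∧ Ideal.Quotient.mk _ p.1.2.1 ∣ x} = 4 := by
  obtain ⟨x, rfl⟩ := Ideal.Quotient.mk_surjective x
  rw [← gUnits]
  symm
  set d := EuclideanDomain.gcd x η.1 with hd
  obtain ⟨g, hg⟩ := EuclideanDomain.gcd_dvd_right x η.1
  obtain ⟨y, hy⟩ := EuclideanDomain.gcd_dvd_left x η.1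
  rw [← hd] at hg hy
  have hbez := EuclideanDomain.gcd_eq_gcd_ab x η.1
  rw [← hd] at hbez
  have hd0 : d ≠ 0 := by intro h; rw [h] at hg; simp at hg; exact η.2 hg
  have hg0 : g ≠ 0 := by intro h; rw [h] at hg; simp at hg; exact η.2 hg
  apply Nat.card_eq_of_bijective (f := fun u : GaussianIntˣ =>
    ⟨⟨(⟨g * (u⁻¹ : GaussianIntˣ), mul_ne_zero hg0 (Units.ne_zero _)⟩,
      ⟨d * u, mul_ne_zero hd0 (Units.ne_zero _)⟩), by
        simp only; rw [hg]; linear_combination (d * g) * u.inv_mul⟩, by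
        simp only
        rw [mk_dvd, mk_dvd]
        refine ⟨⟨EuclideanDomain.gcdA x η.1 * u, EuclideanDomain.gcdB x η.1 * u, ?_⟩,
          ⟨y * (u⁻¹ : GaussianIntˣ), 0, ?_⟩⟩
        · linear_combination (u : GaussianInt) * hbez
        · linear_combination hy - d * y * u.inv_mul⟩)
  constructor
  · intro u v huv
    simp only [Subtype.mk.injEq, Prod.mk.injEq] at huv
    exact Units.ext (mul_left_cancel₀ hd0 huv.2)
  · rintro ⟨⟨⟨a, b⟩, hab⟩, h1, h2⟩
    simp only at hab h1 h2
    rw [mk_dvd] at h1 h2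
    obtain ⟨c, k, h1⟩ := h1
    obtain ⟨c', k', h2⟩ := h2
    have hdb : d ∣ b.1 := ⟨y * c + g * k, by linear_combination h1 + c * hy + k * hg⟩
    have hbη : b.1 ∣ η.1 := ⟨a.1, by rw [← hab]; ring⟩
    have hbx : b.1 ∣ x := by
      rw [h2]; exact dvd_add (dvd_mul_right _ _) (hbη.mul_right _)
    have hbd : b.1 ∣ d := EuclideanDomain.dvd_gcd hbx hbη
    obtain ⟨u, hu⟩ := associated_of_dvd_dvd hdb hbd
    refine ⟨u, ?_⟩
    simp only [Subtype.mk.injEq, Prod.ext_iff, Subtype.ext_iff]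
    refine ⟨?_, hu⟩
    apply mul_right_cancel₀ b.2
    rw [hab, hg, ← hu]
    linear_combination (d * g) * u.inv_mul

theorem phi_sum (η : NZ) [Fintype {p : NZ × NZ // p.1.1 * p.2.1 = η.1}] :
    ∑ p : {p : NZ × NZ // p.1.1 * p.2.1 = η.1}, (gaussianPhi p.1.1.1 : ℝ) = 4 * (η.1.norm : ℝ) := by
  haveI := gFinite η.1 η.2
  haveI : Fintype (GaussianInt ⧸ Ideal.span ({η.1} : Set GaussianInt)) := Fintype.ofFinite _
  classical
  have : ∑ p : {p : NZ × NZ // p.1.1 * p.2.1 = η.1}, gaussianPhi p.1.1.1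
      = 4 * Nat.card (GaussianInt ⧸ Ideal.span ({η.1} : Set GaussianInt)) := by
    have h1 : ∀ p : {p : NZ × NZ // p.1.1 * p.2.1 = η.1}, gaussianPhi p.1.1.1 =
        ∑ x : GaussianInt ⧸ Ideal.span ({η.1} : Set GaussianInt),
          if (x ∣ Ideal.Quotient.mk _ p.1.2.1 ∧ Ideal.Quotient.mk _ p.1.2.1 ∣ x) then 1 else 0 := by
      intro p
      rw [phi_eq _ _ _ p.2 η.2, Nat.card_eq_fintype_card, Fintype.card_subtype, Finset.card_filter]
    rw [Finset.sum_congr rfl fun p _ => h1 p, Finset.sum_comm]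
    have h2 := fib_card η
    simp_rw [Nat.card_eq_fintype_card, Fintype.card_subtype, Finset.card_filter] at h2
    rw [Finset.sum_congr rfl fun x _ => h2 x]
    simp [mul_comm]
  have h3 := gCard η.1
  have h4 : (η.1.norm : ℝ) = Nat.card (GaussianInt ⧸ Ideal.span ({η.1} : Set GaussianInt)) := by
    rw [← h3]; simp
  rw [h4]
  exact_mod_cast this

theorem phi_le (γ : NZ) : (gaussianPhi γ.1 : ℝ) ≤ γ.1.norm := by
  haveI := gFinite γ.1 γ.2
  have h3 := gCard γ.1
  have h4 : (γ.1.norm : ℝ) = Nat.card (GaussianInt ⧸ Ideal.span ({γ.1} : Set GaussianInt)) := by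
    rw [← h3]; simp
  rw [h4]
  exact_mod_cast Nat.card_le_card_of_injective _ Units.val_injective

theorem norm_pos' (γ : NZ) : (0 : ℝ) < γ.1.norm := by
  exact_mod_cast GaussianInt.norm_pos.2 γ.2

theorem summ (t : ℝ) (ht : 1 < t) : Summable (fun γ : NZ => (γ.1.norm : ℝ) ^ (-t)) := by
  have h := EisensteinSeries.summable_one_div_norm_rpow (k := 2 * t) (by linarith)
  have h2 := h.comp_injective (i := fun γ : NZ => ![γ.1.re, γ.1.im]) (by
    intro a b hab
    have h0 := congrFun hab 0
    have h1 := congrFun hab 1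
    exact Subtype.ext (Zsqrtd.ext h0 h1))
  refine Summable.of_nonneg_of_le (fun γ => Real.rpow_nonneg (norm_pos' γ).le _) (fun γ => ?_) h2
  have hp := norm_pos' γ
  simp only [Function.comp]
  set v : Fin 2 → ℤ := ![γ.1.re, γ.1.im] with hv
  have hle : ‖v‖ ^ 2 ≤ (γ.1.norm : ℝ) := by
    have h3 : (γ.1.norm : ℝ) = (γ.1.re : ℝ) ^ 2 + (γ.1.im : ℝ) ^ 2 := by
      rw [Zsqrtd.norm_def]; push_cast; ring
    have : ‖v‖ ≤ Real.sqrt (γ.1.norm : ℝ) := by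
      rw [pi_norm_le_iff_of_nonneg (Real.sqrt_nonneg _)]
      intro i
      rw [h3]
      fin_cases i <;> simp only [hv, Int.norm_eq_abs] <;> apply Real.abs_le_sqrt <;> simp <;> positivity
    calc ‖v‖ ^ 2 ≤ Real.sqrt (γ.1.norm : ℝ) ^ 2 := by gcongr
      _ = _ := Real.sq_sqrt hp.le
  have hv0 : 0 < ‖v‖ := by
    rw [norm_pos_iff]
    intro h0
    exact γ.2 (Zsqrtd.ext (by simpa [hv] using congrFun h0 0) (by simpa [hv] using congrFun h0 1))
  calc (γ.1.norm : ℝ) ^ (-t) ≤ (‖v‖ ^ 2) ^ (-t) :=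
        Real.rpow_le_rpow_of_nonpos (by positivity) hle (by linarith)
    _ = ‖v‖ ^ (-(2 * t)) := by
        rw [← Real.rpow_natCast, ← Real.rpow_mul hv0.le]; congr 1; push_cast; ring

theorem norm_mul_rpow (γ : NZ) (s : ℝ) :
    (γ.1.norm : ℝ) * (γ.1.norm : ℝ) ^ (-s) = (γ.1.norm : ℝ) ^ (-(s - 1)) := by
  rw [show -(s - 1) = 1 + -s by ring, Real.rpow_add (norm_pos' γ), Real.rpow_one]

theorem gaussian_totient_dirichlet_series (s : ℝ) (hs : 2 < s) :
    Summable (fun γ : {γ : GaussianInt // γ ≠ 0} =>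
      (gaussianPhi γ.1 : ℝ) * ((γ.1.norm : ℝ)) ^ (-s)) ∧
    Summable (fun γ : {γ : GaussianInt // γ ≠ 0} => ((γ.1.norm : ℝ)) ^ (-s)) ∧
    Summable (fun γ : {γ : GaussianInt // γ ≠ 0} => ((γ.1.norm : ℝ)) ^ (-(s - 1))) ∧
    (∑' γ : {γ : GaussianInt // γ ≠ 0},
        (gaussianPhi γ.1 : ℝ) * ((γ.1.norm : ℝ)) ^ (-s)) *
      (∑' γ : {γ : GaussianInt // γ ≠ 0}, ((γ.1.norm : ℝ)) ^ (-s)) =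
      4 * ∑' γ : {γ : GaussianInt // γ ≠ 0}, ((γ.1.norm : ℝ)) ^ (-(s - 1)) := by
  have hB := summ s (by linarith)
  have hC := summ (s - 1) (by linarith)
  have hn : ∀ (t : ℝ) (γ : NZ), 0 ≤ (γ.1.norm : ℝ) ^ t :=
    fun t γ => Real.rpow_nonneg (norm_pos' γ).le _
  have hA : Summable (fun γ : NZ => (gaussianPhi γ.1 : ℝ) * ((γ.1.norm : ℝ)) ^ (-s)) := by
    refine Summable.of_nonneg_of_le (fun γ => mul_nonneg (Nat.cast_nonneg _) (hn _ γ))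
      (fun γ => ?_) hC
    rw [← norm_mul_rpow]
    exact mul_le_mul_of_nonneg_right (phi_le γ) (hn _ γ)
  refine ⟨hA, hB, hC, ?_⟩
  have hAB := hA.mul_of_nonneg hB (fun γ => mul_nonneg (Nat.cast_nonneg _) (hn _ γ)) (hn _)
  rw [hA.tsum_mul_tsum hB hAB]
  let m : NZ × NZ → NZ := fun p => ⟨p.1.1 * p.2.1, mul_ne_zero p.1.2 p.2.2⟩
  let e : (Σ η : NZ, {p : NZ × NZ // p.1.1 * p.2.1 = η.1}) ≃ NZ × NZ :=
    { toFun := fun q => q.2.1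
      invFun := fun p => ⟨m p, p, rfl⟩
      left_inv := by
        rintro ⟨η, p, hp⟩
        have : m p = η := Subtype.ext hp
        subst this
        rfl
      right_inv := fun p => rfl }
  rw [← e.tsum_eq]
  have hAB' := (e.summable_iff).2 hAB
  refine (Summable.tsum_sigma hAB').trans ?_
  rw [← tsum_mul_left]
  refine tsum_congr fun η => ?_
  haveI := fib_finite η
  haveI : Fintype {p : NZ × NZ // p.1.1 * p.2.1 = η.1} := Fintype.ofFinite _
  rw [tsum_fintype, ← norm_mul_rpow, ← mul_assoc, ← phi_sum η, Finset.sum_mul]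
  refine Finset.sum_congr rfl fun p _ => ?_
  change ((gaussianPhi p.1.1.1 : ℝ) * (p.1.1.1.norm : ℝ) ^ (-s)) * (p.1.2.1.norm : ℝ) ^ (-s) = _
  have hN : (p.1.1.1.norm : ℝ) * (p.1.2.1.norm : ℝ) = (η.1.norm : ℝ) := by
    have := congrArg Zsqrtd.norm p.2
    rw [Zsqrtd.norm_mul] at this
    exact_mod_cast this
  rw [mul_assoc, ← Real.mul_rpow (norm_pos' _).le (norm_pos' _).le, hN]
end

section
/- Let k ≥ 6 be an even integer and define, for real x > 0, W(x) = (1/2π)·∫_ℝ (2π)^{−2s}·(Γ(s + 1)·Γ(s + k − 1)/Γ(k − 1))·(1 − s²)·x^{−s}·s^{−1} dt, where s = 2 + it and Γ is the complex Gamma function. Then for every A > 0 there exists a constant C_A > 0, independent of k and x, such that |W(x)| ≤ C_A·(1 + x/k)^{−A} for all x > 0. -/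
open Real Complex

/-- The weight function `W` from the approximate functional equation:
`W(x) = (1/2π)·∫_ℝ (2π)^{−2s}·(Γ(s+1)Γ(s+k−1)/Γ(k−1))·(1−s²)·x^{−s}·s^{−1} dt` with `s = 2+it`. -/
noncomputable def approxFEWeight (k : ℕ) (x : ℝ) : ℂ :=
  (1 / (2 * (π : ℂ))) * ∫ t : ℝ,
    (2 * (π : ℂ)) ^ (-2 * ((2 : ℂ) + t * Complex.I)) *
      (Complex.Gamma (((2 : ℂ) + t * Complex.I) + 1) *
        Complex.Gamma (((2 : ℂ) + t * Complex.I) + (k : ℂ) - 1) /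
        Complex.Gamma ((k : ℂ) - 1)) *
      (1 - ((2 : ℂ) + t * Complex.I) ^ 2) *
      (x : ℂ) ^ (-((2 : ℂ) + t * Complex.I)) / ((2 : ℂ) + t * Complex.I)

open MeasureTheory Set

/-- The function whose Mellin transform is `Γ(s)(1-s²)`. -/
noncomputable def afePhi (u : ℝ) : ℂ := (Real.exp (-u) : ℂ) * (1 + u - u ^ 2)

theorem afe_expMellin {s : ℂ} (hs : 0 < s.re) :
    HasMellin (fun x : ℝ => ((Real.exp (-x) : ℝ) : ℂ)) s (Complex.Gamma s) := by
  constructor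
  · have := Complex.GammaIntegral_convergent hs
    simpa only [MellinConvergent, smul_eq_mul, mul_comm] using this
  · rw [Complex.Gamma_eq_integral hs, Complex.GammaIntegral_eq_mellin]

theorem afe_powMellin (n : ℕ) {s : ℂ} (hs : 0 < s.re) :
    HasMellin (fun x : ℝ => (x : ℂ) ^ (n : ℂ) • ((Real.exp (-x) : ℝ) : ℂ)) s
      (Complex.Gamma (s + n)) := by
  have h : 0 < (s + n).re := by
    simp only [Complex.add_re, Complex.natCast_re]; positivity
  constructor
  · rw [MellinConvergent.cpow_smul]; exact (afe_expMellin h).1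
  · rw [mellin_cpow_smul]; exact (afe_expMellin h).2

theorem afePhi_mellin {s : ℂ} (hs : 0 < s.re) :
    HasMellin afePhi s (Complex.Gamma s * (1 - s ^ 2)) := by
  have h01 := hasMellin_add (afe_powMellin 0 hs).1 (afe_powMellin 1 hs).1
  have h := hasMellin_sub h01.1 (afe_powMellin 2 hs).1
  rw [h01.2, (afe_powMellin 0 hs).2, (afe_powMellin 1 hs).2, (afe_powMellin 2 hs).2] at h
  have hs0 : s ≠ 0 := by rintro rfl; simp at hs
  have hs1 : s + 1 ≠ 0 := by
    intro h; have := congrArg Complex.re h; simp at this; linarith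
  have e : Complex.Gamma (s + (0 : ℕ)) + Complex.Gamma (s + (1 : ℕ)) - Complex.Gamma (s + (2 : ℕ))
      = Complex.Gamma s * (1 - s ^ 2) := by
    have h2 : s + (2 : ℕ) = (s + 1) + 1 := by push_cast; ring
    rw [h2, Complex.Gamma_add_one _ hs1]
    push_cast
    rw [Complex.Gamma_add_one _ hs0, add_zero]
    ring
  rw [e] at h
  convert h using 1
  funext u
  simp only [afePhi, Complex.cpow_natCast, smul_eq_mul]
  ring

theorem afe_line_re (t : ℝ) : ((2 : ℂ) + t * Complex.I).re = 2 := by simp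

theorem afe_Gamma_norm_le {s : ℂ} (hs : 0 < s.re) : ‖Complex.Gamma s‖ ≤ Real.Gamma s.re := by
  rw [Complex.Gamma_eq_integral hs, Complex.GammaIntegral, Real.Gamma_eq_integral hs]
  refine (norm_integral_le_integral_norm _).trans (le_of_eq ?_)
  refine setIntegral_congr_fun measurableSet_Ioi fun y hy => ?_
  have hy : 0 < y := hy
  simp only [norm_mul, Complex.norm_cpow_eq_rpow_re_of_pos hy, Complex.norm_real, Real.norm_eq_abs,
    abs_of_pos (Real.exp_pos _), Complex.sub_re, Complex.one_re]

theorem afe_G_bound (t : ℝ) :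
    ‖Complex.Gamma ((2 : ℂ) + t * Complex.I) * (1 - ((2 : ℂ) + t * Complex.I) ^ 2)‖
      ≤ 240 * (1 + t ^ 2)⁻¹ := by
  set s : ℂ := (2 : ℂ) + t * Complex.I with hsdef
  have hre : s.re = 2 := by simp [hsdef]
  have him : s.im = t := by simp [hsdef]
  have hns : ‖s‖ ^ 2 = 4 + t ^ 2 := by
    rw [← Complex.normSq_eq_norm_sq, Complex.normSq_apply, hre, him]; ring
  have key : ∀ j : ℕ, ‖s‖ ≤ ‖s + j‖ := by
    intro j
    have : ‖s + j‖ ^ 2 = (2 + j) ^ 2 + t ^ 2 := by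
      rw [← Complex.normSq_eq_norm_sq, Complex.normSq_apply]; simp [hre, him]; ring
    refine le_of_sq_le_sq ?_ (norm_nonneg _)
    rw [this, hns]
    have : (0 : ℝ) ≤ j := by positivity
    nlinarith
  have spos : 0 < ‖s‖ := by
    rw [norm_pos_iff]; rintro h; rw [h] at hre; simp at hre
  have hne : ∀ j : ℕ, s + j ≠ 0 := fun j => norm_pos_iff.1 (spos.trans_le (key j))
  have hG : Complex.Gamma (s + 4) = (s + 3) * ((s + 2) * ((s + 1) * (s * Complex.Gamma s))) := by
    have h0 := hne 0
    have h1 := hne 1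
    have h2 := hne 2
    have h3 := hne 3
    push_cast at h0 h1 h2 h3
    rw [add_zero] at h0
    rw [show s + 4 = (s + 3) + 1 by ring, Complex.Gamma_add_one _ h3,
      show s + 3 = (s + 2) + 1 by ring, Complex.Gamma_add_one _ h2,
      show s + 2 = (s + 1) + 1 by ring, Complex.Gamma_add_one _ h1, Complex.Gamma_add_one _ h0]
  have hle : ‖Complex.Gamma (s + 4)‖ ≤ 120 := by
    have h := afe_Gamma_norm_le (s := s + 4) (by simp [hre]; norm_num)
    have e : (s + 4).re = ((5 : ℕ) : ℝ) + 1 := by simp [hre]; norm_num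
    rw [e, Real.Gamma_nat_eq_factorial] at h
    norm_num [Nat.factorial] at h
    exact h
  rw [hG] at hle
  simp only [norm_mul] at hle ⊢
  have k1 := key 1
  have k2 := key 2
  have k3 := key 3
  push_cast at k1 k2 k3
  have hle' : ‖s‖ ^ 4 * ‖Complex.Gamma s‖ ≤ 120 := by
    refine le_trans ?_ hle
    calc ‖s‖ ^ 4 * ‖Complex.Gamma s‖ = ‖s‖ * (‖s‖ * (‖s‖ * (‖s‖ * ‖Complex.Gamma s‖))) := by ring
      _ ≤ _ := by gcongr
  have h1 : ‖1 - s ^ 2‖ ≤ 1 + ‖s‖ ^ 2 := by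
    refine (norm_sub_le _ _).trans ?_; simp
  have e4 : ‖s‖ ^ 4 = (4 + t ^ 2) ^ 2 := by rw [← hns]; ring
  rw [e4] at hle'
  rw [hns] at h1
  have hg := norm_nonneg (Complex.Gamma s)
  rw [← div_eq_mul_inv, le_div_iff₀ (by positivity)]
  calc ‖Complex.Gamma s‖ * ‖1 - s ^ 2‖ * (1 + t ^ 2)
      ≤ ‖Complex.Gamma s‖ * (1 + (4 + t ^ 2)) * (1 + t ^ 2) := by gcongr
    _ ≤ 2 * ((4 + t ^ 2) ^ 2 * ‖Complex.Gamma s‖) := by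
      nlinarith [mul_nonneg hg (sq_nonneg t), mul_nonneg hg (sq_nonneg (t ^ 2))]
    _ ≤ 240 := by linarith

theorem afe_G_continuous : Continuous fun t : ℝ =>
    Complex.Gamma ((2 : ℂ) + t * Complex.I) * (1 - ((2 : ℂ) + t * Complex.I) ^ 2) := by
  refine Continuous.mul ?_ (by fun_prop)
  rw [continuous_iff_continuousAt]
  intro t
  refine ContinuousAt.comp (g := Complex.Gamma) ?_ (by fun_prop)
  refine (Complex.differentiableAt_Gamma _ fun m h => ?_).continuousAt
  have := congrArg Complex.re h
  simp at this
  have hm : (0 : ℝ) ≤ m := by positivity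
  linarith

theorem afe_G_integrable : Integrable fun t : ℝ =>
    Complex.Gamma ((2 : ℂ) + t * Complex.I) * (1 - ((2 : ℂ) + t * Complex.I) ^ 2) :=
  Integrable.mono' (integrable_inv_one_add_sq.const_mul 240)
    afe_G_continuous.aestronglyMeasurable (Filter.Eventually.of_forall afe_G_bound)

theorem afe_inversion {u : ℝ} (hu : 0 < u) :
    (1 / (2 * (π : ℂ))) * ∫ t : ℝ, (u : ℂ) ^ (-((2 : ℂ) + t * Complex.I)) *
      (Complex.Gamma ((2 : ℂ) + t * Complex.I) * (1 - ((2 : ℂ) + t * Complex.I) ^ 2))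
      = afePhi u := by
  have e : ∀ t : ℝ, mellin afePhi (((2 : ℝ) : ℂ) + t * Complex.I) =
      Complex.Gamma ((2 : ℂ) + t * Complex.I) * (1 - ((2 : ℂ) + t * Complex.I) ^ 2) := by
    intro t
    rw [(afePhi_mellin (by simp)).2]; simp
  have h := mellinInv_mellin_eq 2 afePhi hu (afePhi_mellin (by simp)).1
    (by
      unfold Complex.VerticalIntegrable
      simp_rw [e]; exact afe_G_integrable)
    (by unfold afePhi; fun_prop)
  rw [← h, mellinInv]
  simp_rw [e]
  rw [Complex.real_smul]
  simp

theorem afePhi_bound (n : ℕ) {u : ℝ} (hu : 0 < u) :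
    ‖afePhi u‖ * u ^ n ≤ n.factorial + (n + 1).factorial + (n + 2).factorial := by
  have hb : ∀ m : ℕ, Real.exp (-u) * u ^ m ≤ m.factorial := by
    intro m
    have := Real.pow_div_factorial_le_exp u hu.le m
    rw [div_le_iff₀ (by positivity)] at this
    rw [Real.exp_neg, inv_mul_le_iff₀ (Real.exp_pos _)]
    exact this
  have e : afePhi u = ((Real.exp (-u) * (1 + u - u ^ 2) : ℝ) : ℂ) := by
    simp [afePhi]
  rw [e, Complex.norm_real, Real.norm_eq_abs, abs_mul, abs_of_pos (Real.exp_pos _)]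
  have h1 : |1 + u - u ^ 2| ≤ 1 + u + u ^ 2 := by
    rw [abs_le]; constructor <;> nlinarith [sq_nonneg u]
  calc Real.exp (-u) * |1 + u - u ^ 2| * u ^ n ≤ Real.exp (-u) * (1 + u + u ^ 2) * u ^ n := by gcongr
    _ = Real.exp (-u) * u ^ n + Real.exp (-u) * u ^ (n + 1) + Real.exp (-u) * u ^ (n + 2) := by ring
    _ ≤ _ := by gcongr <;> apply hb

theorem afe_gammaInt (m : ℕ) :
    IntegrableOn (fun y : ℝ => Real.exp (-y) * y ^ m) (Ioi 0) ∧
    ∫ y in Ioi (0 : ℝ), Real.exp (-y) * y ^ m = m.factorial := by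
  have hpos : (0 : ℝ) < (m : ℝ) + 1 := by positivity
  have h1 := Real.GammaIntegral_convergent hpos
  have h2 := Real.Gamma_eq_integral hpos
  simp only [add_sub_cancel_right, Real.rpow_natCast] at h1 h2
  rw [Real.Gamma_nat_eq_factorial] at h2
  exact ⟨h1, h2.symm⟩

/-- The kernel of the double integral. -/
noncomputable def afeF (m : ℕ) (c : ℝ) (t y : ℝ) : ℂ :=
  ((Real.exp (-y) * y ^ m : ℝ) : ℂ) * (((c / y : ℝ) : ℂ) ^ (-((2 : ℂ) + t * Complex.I)) *
    (Complex.Gamma ((2 : ℂ) + t * Complex.I) * (1 - ((2 : ℂ) + t * Complex.I) ^ 2)))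

theorem afeF_integrable (m : ℕ) {c : ℝ} (hc : 0 < c) :
    Integrable (Function.uncurry (afeF m c))
      ((volume : Measure ℝ).prod (volume.restrict (Ioi (0 : ℝ)))) := by
  have hb := afe_G_integrable.norm.mul_prod
    (((afe_gammaInt (m + 2)).1.integrable).const_mul ((c ^ 2)⁻¹))
  refine Integrable.mono' hb ?_ ?_
  · refine Measurable.aestronglyMeasurable ?_
    have hG := (afe_G_continuous.comp (continuous_fst (X := ℝ) (Y := ℝ))).measurable
    have h1 : Measurable fun p : ℝ × ℝ => ((Real.exp (-p.2) * p.2 ^ m : ℝ) : ℂ) := by fun_prop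
    have h2 : Measurable fun p : ℝ × ℝ =>
        ((c / p.2 : ℝ) : ℂ) ^ (-((2 : ℂ) + p.1 * Complex.I)) := by fun_prop
    exact h1.mul (h2.mul hG)
  · have : ∀ᵐ p : ℝ × ℝ ∂((volume : Measure ℝ).prod (volume.restrict (Ioi (0 : ℝ)))), p.2 ∈ Ioi (0 : ℝ) :=
      Measure.quasiMeasurePreserving_snd.ae (ae_restrict_mem measurableSet_Ioi)
    filter_upwards [this] with p hp
    have hp : 0 < p.2 := hp
    simp only [Function.uncurry, afeF]
    rw [norm_mul, norm_mul, Complex.norm_cpow_eq_rpow_re_of_pos (by positivity), Complex.norm_real,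
      Real.norm_eq_abs, abs_of_nonneg (by positivity)]
    have e : (-((2 : ℂ) + p.1 * Complex.I)).re = -((2 : ℕ) : ℝ) := by simp
    rw [e, Real.rpow_neg (by positivity), Real.rpow_natCast]
    apply le_of_eq
    field_simp
    ring

theorem afe_repr (m : ℕ) {x : ℝ} (hx : 0 < x) :
    approxFEWeight (m + 2) x = (m.factorial : ℂ)⁻¹ *
      ∫ y in Ioi (0 : ℝ), ((Real.exp (-y) * y ^ m : ℝ) : ℂ) * afePhi (4 * Real.pi ^ 2 * x / y) := by
  set c : ℝ := 4 * Real.pi ^ 2 * x with hcdef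
  have hpi := Real.pi_pos
  have hc : 0 < c := by positivity
  have hsw := integral_integral_swap (afeF_integrable m hc)
  have hR : ∫ y in Ioi (0 : ℝ), ((Real.exp (-y) * y ^ m : ℝ) : ℂ) * afePhi (c / y) =
      (1 / (2 * (Real.pi : ℂ))) * ∫ y in Ioi (0 : ℝ), ∫ t : ℝ, afeF m c t y := by
    rw [← integral_const_mul]
    refine setIntegral_congr_fun measurableSet_Ioi fun y hy => ?_
    have hy : 0 < y := hy
    simp only [afeF]
    rw [integral_const_mul, ← afe_inversion (div_pos hc hy)]
    ring
  rw [hR, ← hsw, approxFEWeight, ← mul_assoc, mul_comm _ (1 / (2 * (Real.pi : ℂ))), mul_assoc]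
  congr 1
  rw [← integral_const_mul]
  refine integral_congr_ae (Filter.Eventually.of_forall fun t => ?_)
  simp only [afeF]
  set s : ℂ := (2 : ℂ) + t * Complex.I with hsdef
  have hre : s.re = 2 := by simp [hsdef]
  have hs0 : s ≠ 0 := by intro h; rw [h] at hre; simp at hre
  have hint : ∫ y in Ioi (0 : ℝ), ((Real.exp (-y) * y ^ m : ℝ) : ℂ) *
      (((c / y : ℝ) : ℂ) ^ (-s) * (Complex.Gamma s * (1 - s ^ 2))) =
      Complex.Gamma (s + m + 1) * ((c : ℂ) ^ (-s) * (Complex.Gamma s * (1 - s ^ 2))) := by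
    rw [Complex.Gamma_eq_integral (s := s + m + 1) (by simp [hre]; positivity), Complex.GammaIntegral,
      ← integral_mul_const]
    refine setIntegral_congr_fun measurableSet_Ioi fun y hy => ?_
    have hy : 0 < y := hy
    have hyc : (y : ℂ) ≠ 0 := by exact_mod_cast hy.ne'
    have e1 : ((c / y : ℝ) : ℂ) ^ (-s) = (c : ℂ) ^ (-s) * (y : ℂ) ^ s := by
      have := Complex.mul_cpow_ofReal_nonneg (div_pos hc hy).le hy.le (-s)
      rw [← Complex.ofReal_mul, div_mul_cancel₀ _ hy.ne'] at this
      rw [this, mul_assoc, ← Complex.cpow_add _ _ hyc]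
      simp
    have e2 : (y : ℂ) ^ (s + m + 1 - 1) = (y : ℂ) ^ s * (y : ℂ) ^ m := by
      rw [add_sub_cancel_right, Complex.cpow_add _ _ hyc, Complex.cpow_natCast]
    beta_reduce
    rw [e1, e2]
    push_cast
    ring
  rw [hint]
  have hcs : (c : ℂ) ^ (-s) = (2 * (Real.pi : ℂ)) ^ (-2 * s) * (x : ℂ) ^ (-s) := by
    have e3 : c = (2 * Real.pi) ^ 2 * x := by rw [hcdef]; ring
    rw [e3, Complex.ofReal_mul, Complex.mul_cpow_ofReal_nonneg (by positivity) hx.le]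
    congr 1
    have e4 : -2 * s = ((2 : ℝ) : ℂ) * (-s) := by push_cast; ring
    rw [e4, show (2 * (Real.pi : ℂ)) = ((2 * Real.pi : ℝ) : ℂ) by push_cast; rfl,
      Complex.cpow_mul_ofReal_nonneg (by positivity)]
    congr 1
    norm_cast
  rw [hcs, show s + ((m + 2 : ℕ) : ℂ) - 1 = s + m + 1 by push_cast; ring,
    show ((m + 2 : ℕ) : ℂ) - 1 = m + 1 by push_cast; ring, Complex.Gamma_nat_eq_factorial,
    Complex.Gamma_add_one _ hs0]
  have : (m.factorial : ℂ) ≠ 0 := by exact_mod_cast m.factorial_ne_zero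
  field_simp

theorem afe_weight_bound (n m : ℕ) {x : ℝ} (hx : 0 < x) :
    ‖approxFEWeight (m + 2) x‖ ≤
      ((n.factorial + (n + 1).factorial + (n + 2).factorial : ℝ) * (n + 1) ^ n) *
        (((m + 2 : ℕ) : ℝ) / x) ^ n := by
  set D : ℝ := n.factorial + (n + 1).factorial + (n + 2).factorial with hD
  have hDpos : 0 < D := by positivity
  have hpi : (3 : ℝ) < Real.pi := Real.pi_gt_three
  rw [afe_repr m hx, norm_mul, norm_inv, Complex.norm_natCast,
    inv_mul_le_iff₀ (by positivity)]
  have hI : ‖∫ y in Ioi (0 : ℝ), ((Real.exp (-y) * y ^ m : ℝ) : ℂ) *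
      afePhi (4 * Real.pi ^ 2 * x / y)‖ ≤
      ∫ y in Ioi (0 : ℝ), D * (x ^ n)⁻¹ * (Real.exp (-y) * y ^ (m + n)) := by
    refine norm_integral_le_of_norm_le ((afe_gammaInt (m + n)).1.integrable.const_mul _) ?_
    filter_upwards [ae_restrict_mem measurableSet_Ioi] with y hy
    have hy : 0 < y := hy
    have hb := afePhi_bound n (u := 4 * Real.pi ^ 2 * x / y) (by positivity)
    rw [← hD] at hb
    have hle : x / y ≤ 4 * Real.pi ^ 2 * x / y := by
      gcongr
      have : 1 ≤ 4 * Real.pi ^ 2 := by nlinarith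
      nlinarith
    have hb2 : ‖afePhi (4 * Real.pi ^ 2 * x / y)‖ * (x / y) ^ n ≤ D := by
      refine le_trans ?_ hb
      gcongr
    rw [norm_mul, Complex.norm_real, Real.norm_eq_abs, abs_of_nonneg (by positivity)]
    have hb3 : ‖afePhi (4 * Real.pi ^ 2 * x / y)‖ ≤ D * (x ^ n)⁻¹ * y ^ n := by
      rw [div_pow, ← mul_div_assoc, div_le_iff₀ (by positivity)] at hb2
      rw [mul_right_comm D, ← div_eq_mul_inv, le_div_iff₀ (by positivity)]
      exact hb2
    calc _ ≤ Real.exp (-y) * y ^ m * (D * (x ^ n)⁻¹ * y ^ n) := by gcongr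
      _ = _ := by ring
  refine hI.trans ?_
  rw [integral_const_mul, (afe_gammaInt (m + n)).2]
  have hf : ((m + n).factorial : ℝ) ≤ m.factorial * ((n + 1 : ℝ) * ((m + 2 : ℕ) : ℝ)) ^ n := by
    have h1 : (m + n).factorial ≤ m.factorial * (m + n) ^ n := by
      rw [← Nat.factorial_mul_ascFactorial]
      exact Nat.mul_le_mul_left _ (Nat.ascFactorial_le_pow_add m n)
    have h2 : m + n ≤ (n + 1) * (m + 2) := by nlinarith
    have h3 := h1.trans (Nat.mul_le_mul_left m.factorial (Nat.pow_le_pow_left h2 n))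
    exact_mod_cast h3
  calc D * (x ^ n)⁻¹ * ((m + n).factorial : ℝ)
      ≤ D * (x ^ n)⁻¹ * (m.factorial * ((n + 1 : ℝ) * ((m + 2 : ℕ) : ℝ)) ^ n) := by gcongr
    _ = _ := by rw [mul_pow, div_pow]; field_simp

theorem approxFEWeight_decay (A : ℝ) (hA : 0 < A) :
    ∃ C : ℝ, 0 < C ∧ ∀ k : ℕ, 6 ≤ k → Even k → ∀ x : ℝ, 0 < x →
      ‖approxFEWeight k x‖ ≤ C * (1 + x / k) ^ (-A) := by
  obtain ⟨n, hn⟩ := exists_nat_ge A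
  set E : ℝ := (n.factorial + (n + 1).factorial + (n + 2).factorial : ℝ) * (n + 1) ^ n with hE
  have hEpos : 0 < E := by positivity
  refine ⟨2 ^ n * (4 + E), by positivity, fun k hk _ x hx => ?_⟩
  obtain ⟨m, rfl⟩ : ∃ m, k = m + 2 := ⟨k - 2, by omega⟩
  have h0 := afe_weight_bound 0 m hx
  have h1 := afe_weight_bound n m hx
  rw [← hE] at h1
  norm_num [Nat.factorial] at h0
  have hkpos : (0 : ℝ) < ((m + 2 : ℕ) : ℝ) := by positivity
  set z : ℝ := x / ((m + 2 : ℕ) : ℝ) with hz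
  have hzpos : 0 < z := by positivity
  have hinv : ((m + 2 : ℕ) : ℝ) / x = z⁻¹ := by rw [hz, inv_div]
  rw [hinv] at h1
  have hpow : (1 + z) ^ A ≤ (1 + z) ^ n := by
    rw [← Real.rpow_natCast]
    exact Real.rpow_le_rpow_of_exponent_le (by linarith) hn
  rw [Real.rpow_neg (by positivity), ← div_eq_mul_inv, le_div_iff₀ (by positivity)]
  set w := ‖approxFEWeight (m + 2) x‖ with hw
  have hw0 : 0 ≤ w := norm_nonneg _
  refine (mul_le_mul_of_nonneg_left hpow hw0).trans ?_
  rcases le_total z 1 with h | h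
  · calc w * (1 + z) ^ n ≤ 4 * 2 ^ n := by gcongr; linarith
      _ ≤ 2 ^ n * (4 + E) := by nlinarith [pow_pos (two_pos : (0 : ℝ) < 2) n]
  · calc w * (1 + z) ^ n ≤ (E * z⁻¹ ^ n) * (2 * z) ^ n := by gcongr; linarith
      _ = 2 ^ n * E := by rw [mul_pow, inv_pow]; field_simp
      _ ≤ 2 ^ n * (4 + E) := by gcongr; linarith
end
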